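/- Assume that every zero of the Riemann zeta function ζ(s) with 0 < Re(s) < 1 has Re(s) = 1/2. Fix ε ∈ (0, 1/4). Then, as X → ∞, ∫_{(ε)} (ζ'/ζ)(1 + 2α) · Φ̃(1/2 + α) · X^{α} dα = −πi · Φ̃(1/2) + O(X^{−1/5}). Consequently, ∫_{(ε')} ∫_{(ε)} (ζ'/ζ)(1 + 2α) · (ζ'/ζ)(1 + 2β) · Φ̃(1/2 + α) · Φ̃(1/2 + β) · X^{α+β} dα dβ = −π² · Φ̃(1/2)² + O(X^{−1/5}) for any fixed ε, ε' ∈ (0, 1/4). -/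

import Mathlib

noncomputable section

open scoped Classical

open Complex Real Filter Asymptotics MeasureTheory

/-- The Mellin transform `Φ̃(s) = ∫₀^∞ Φ(x) x^{s-1} dx` at a complex point `s`. -/
def mellinC (Φ : ℝ → ℝ) (s : ℂ) : ℂ := ∫ x in Set.Ioi (0:ℝ), (Φ x : ℂ) * (x : ℂ) ^ (s - 1)

/-- The vertical-line integral `∫_{(c)} g(s) ds = i ∫_ℝ g(c + it) dt`. -/
def vertInt (g : ℂ → ℂ) (c : ℝ) : ℂ := Complex.I * ∫ t : ℝ, g ((c : ℂ) + (t : ℂ) * Complex.I)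

/-- Bound on the logarithmic derivative of a nonvanishing holomorphic function on a disc in terms
of its growth, from the Borel–Carathéodory theorem and Cauchy's estimate. -/
theorem norm_logDeriv_le_of_norm_le {f : ℂ → ℂ} {c : ℂ} {r R B : ℝ} (hr : 0 ≤ r) (hrR : r < R)
    (hB : 1 < B) (hf : DifferentiableOn ℂ f (Metric.ball c R))
    (hf0 : ∀ z ∈ Metric.ball c R, f z ≠ 0)
    (hfB : ∀ z ∈ Metric.ball c R, ‖f z‖ ≤ B * ‖f c‖) {z : ℂ} (hz : ‖z - c‖ ≤ r) :
    ‖deriv f z / f z‖ ≤ 2 * Real.log B * ((R + r) / 2) / ((R - r) / 2) ^ 2 := by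
  have hR : 0 < R := hr.trans_lt hrR
  have hcR : c ∈ Metric.ball c R := Metric.mem_ball_self hR
  have hdiv : DifferentiableOn ℂ (fun w ↦ deriv f w / f w) (Metric.ball c R) :=
    (hf.deriv Metric.isOpen_ball).div hf hf0
  obtain ⟨g, hgc, hg⟩ := hdiv.isExactOn_ball.with_val_at c 0
  have hlogB : 0 < Real.log B := Real.log_pos hB
  have hexp : ∀ w ∈ Metric.ball c R, f w * Complex.exp (-g w) = f c := by
    intro w hw
    have hconst := (convex_ball c R).is_const_of_fderivWithin_eq_zero (𝕜 := ℂ)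
      (f := fun w ↦ f w * Complex.exp (-g w)) ?_ ?_ hw hcR
    · simpa [hgc] using hconst
    · intro u hu
      exact ((hf.differentiableAt (Metric.isOpen_ball.mem_nhds hu)).mul
        (hg u hu).differentiableAt.neg.cexp).differentiableWithinAt
    · intro u hu
      have h1 := (hf.differentiableAt (Metric.isOpen_ball.mem_nhds hu)).hasDerivAt.mul
        (hg u hu).neg.cexp
      have h2 : HasDerivAt (fun w ↦ f w * Complex.exp (-g w)) 0 u := by
        refine h1.congr_deriv ?_
        have := hf0 u hu
        field_simp
        ring
      have h3 := h2.hasFDerivAt.hasFDerivWithinAt (s := Metric.ball c R)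
      rw [h3.fderivWithin (Metric.isOpen_ball.uniqueDiffWithinAt hu)]
      ext; simp
  have hre : ∀ w ∈ Metric.ball c R, (g w).re ≤ Real.log B := by
    intro w hw
    have h1 : f w = f c * Complex.exp (g w) := by
      rw [← hexp w hw, mul_assoc, ← Complex.exp_add]; simp
    have h2 := hfB w hw
    rw [h1, norm_mul, Complex.norm_exp, mul_comm] at h2
    have h3 : Real.exp (g w).re ≤ B :=
      le_of_mul_le_mul_right h2 (norm_pos_iff.mpr (hf0 c hcR))
    exact (Real.le_log_iff_exp_le (by linarith)).mpr h3
  set r' := (R + r) / 2 with hr'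
  set δ := (R - r) / 2 with hδ
  have hδ0 : 0 < δ := by rw [hδ]; linarith
  have hgd : DifferentiableOn ℂ g (Metric.ball c R) :=
    fun w hw ↦ (hg w hw).differentiableAt.differentiableWithinAt
  have hgbound : ∀ w, ‖w - c‖ ≤ r' → ‖g w‖ ≤ 2 * Real.log B * r' / δ := by
    intro w hw
    have hmaps : ∀ u ∈ Metric.ball (0 : ℂ) R, c + u ∈ Metric.ball c R := by
      intro u hu; simpa using hu
    have hwR : ‖w - c‖ < R := by rw [hr'] at hw; linarith
    have key := Complex.borelCaratheodory_zero (f := fun u ↦ g (c + u)) (z := w - c) (R := R)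
      (M := Real.log B) hlogB
      (hgd.comp (by fun_prop) hmaps) (fun u hu ↦ hre _ (hmaps u hu)) hR (by simpa using hwR)
      (by simpa using hgc)
    simp only [add_sub_cancel] at key
    refine key.trans ?_
    have : δ ≤ R - ‖w - c‖ := by rw [hδ]; rw [hr'] at hw; linarith
    gcongr
  have hsub : Metric.closedBall z δ ⊆ Metric.ball c R := by
    intro w hw
    rw [Metric.mem_closedBall, dist_eq_norm] at hw
    rw [Metric.mem_ball, dist_eq_norm]
    have := norm_sub_le_norm_sub_add_norm_sub w z c
    rw [hδ] at hw
    linarith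
  have hzR : z ∈ Metric.ball c R := hsub (Metric.mem_closedBall_self hδ0.le)
  rw [← (hg z hzR).deriv]
  refine (Complex.norm_deriv_le_of_forall_mem_sphere_norm_le (C := 2 * Real.log B * r' / δ) hδ0
    (hgd.mono (by rw [closure_ball z hδ0.ne']; exact hsub)).diffContOnCl ?_).trans (le_of_eq ?_)
  · intro w hw
    apply hgbound
    rw [mem_sphere_iff_norm] at hw
    have := norm_sub_le_norm_sub_add_norm_sub w z c
    rw [hr']
    rw [hδ] at hw
    linarith
  · field_simp

/-- The terms of the series for `(s - 1) ζ(s) - 1` obtained by comparing `∑ n⁻ˢ` with `∫ x⁻ˢ`. -/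
def zetaDiffTerm (n : ℕ) (s : ℂ) : ℂ :=
  (s - 1) * ((n + 1 : ℝ) : ℂ) ^ (-s) + ((n + 2 : ℝ) : ℂ) ^ (1 - s) - ((n + 1 : ℝ) : ℂ) ^ (1 - s)

theorem norm_cpow_sub_cpow_le {a x : ℝ} (ha : 0 < a) (hx : x ∈ Set.Icc a (a + 1)) {s : ℂ}
    (hs : 0 < s.re) :
    ‖(x : ℂ) ^ (-s) - (a : ℂ) ^ (-s)‖ ≤ ‖s‖ * a ^ (-s.re - 1) := by
  have hs0 : s ≠ 0 := by rintro rfl; simp at hs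
  have h := (convex_Icc a (a + 1)).norm_image_sub_le_of_norm_hasDerivWithin_le
    (f := fun y : ℝ ↦ (y : ℂ) ^ (-s)) (f' := fun y : ℝ ↦ (-s) * (y : ℂ) ^ (-s - 1))
    (C := ‖s‖ * a ^ (-s.re - 1)) (x := a) (y := x) ?_ ?_ (by simp) hx
  · refine h.trans (mul_le_of_le_one_right (by positivity) ?_)
    rw [Real.norm_eq_abs, abs_le]
    constructor <;> linarith [hx.1, hx.2]
  · intro y hy
    have hy0 : y ≠ 0 := by linarith [hy.1]
    exact (hasDerivAt_ofReal_cpow_const hy0 (r := -s) (by simpa)).hasDerivWithinAt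
  · intro y hy
    have hy0 : 0 < y := by linarith [hy.1]
    rw [norm_mul, norm_neg, Complex.norm_cpow_eq_rpow_re_of_pos hy0]
    simp only [sub_re, neg_re, one_re]
    gcongr ‖s‖ * ?_
    exact Real.rpow_le_rpow_of_nonpos ha hy.1 (by linarith)

theorem norm_zetaDiffTerm_le (n : ℕ) {s : ℂ} (hs : 0 < s.re) :
    ‖zetaDiffTerm n s‖ ≤ ‖s - 1‖ * ‖s‖ * (n + 1 : ℝ) ^ (-s.re - 1) := by
  have ha : (0 : ℝ) < n + 1 := by positivity
  have h := (convex_Icc (n + 1 : ℝ) (n + 1 + 1)).norm_image_sub_le_of_norm_hasDerivWithin_le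
    (f := fun y : ℝ ↦ (y : ℂ) ^ (1 - s) + (s - 1) * ((n + 1 : ℝ) : ℂ) ^ (-s) * y)
    (f' := fun y : ℝ ↦ (1 - s) * (y : ℂ) ^ (-s) + (s - 1) * ((n + 1 : ℝ) : ℂ) ^ (-s))
    (C := ‖s - 1‖ * (‖s‖ * (n + 1 : ℝ) ^ (-s.re - 1))) (x := n + 1) (y := n + 1 + 1)
    ?_ ?_ (by simp) (by simp)
  · convert h using 1
    · congr 1
      rw [zetaDiffTerm, show (n + 2 : ℝ) = n + 1 + 1 by ring]
      push_cast
      ring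
    · simp [mul_assoc]
  · intro y hy
    have hy0 : y ≠ 0 := by linarith [hy.1]
    by_cases hs1 : s = 1
    · subst hs1
      simpa using hasDerivWithinAt_const y _ (1 : ℂ)
    refine HasDerivAt.hasDerivWithinAt (HasDerivAt.add ?_ ?_)
    · have := hasDerivAt_ofReal_cpow_const hy0 (r := 1 - s) (by
        intro h; exact hs1 (by linear_combination -h))
      simpa [sub_sub_cancel_left] using this
    · simpa using (Complex.ofRealCLM.hasDerivAt (x := y)).const_mul
        ((s - 1) * ((n + 1 : ℝ) : ℂ) ^ (-s))
  · intro y hy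
    rw [show (1 - s) * (y : ℂ) ^ (-s) + (s - 1) * ((n + 1 : ℝ) : ℂ) ^ (-s)
      = -((s - 1) * ((y : ℂ) ^ (-s) - ((n + 1 : ℝ) : ℂ) ^ (-s))) by ring, norm_neg, norm_mul]
    gcongr
    exact norm_cpow_sub_cpow_le ha hy hs

theorem summable_nat_add_one_rpow {p : ℝ} (hp : p < -1) :
    Summable fun n : ℕ ↦ (n + 1 : ℝ) ^ p := by
  have := (summable_nat_add_iff 1).mpr (Real.summable_nat_rpow.mpr hp)
  simpa using this

theorem norm_zetaDiffTerm_le_of_half_le (n : ℕ) {s : ℂ} (hs : 1 / 2 ≤ s.re) :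
    ‖zetaDiffTerm n s‖ ≤ ‖s - 1‖ * ‖s‖ * (n + 1 : ℝ) ^ (-3 / 2 : ℝ) := by
  refine (norm_zetaDiffTerm_le n (by linarith)).trans ?_
  gcongr
  · norm_num
  · linarith

theorem differentiable_zetaDiffTerm (n : ℕ) : Differentiable ℂ (zetaDiffTerm n) := by
  have h1 : ((n + 1 : ℝ) : ℂ) ≠ 0 := by norm_cast
  have h2 : ((n + 2 : ℝ) : ℂ) ≠ 0 := by norm_cast
  intro s
  unfold zetaDiffTerm
  refine DifferentiableAt.sub (DifferentiableAt.add (DifferentiableAt.mul (by fun_prop) ?_) ?_) ?_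
  · exact DifferentiableAt.const_cpow (by fun_prop) (Or.inl h1)
  · exact DifferentiableAt.const_cpow (by fun_prop) (Or.inl h2)
  · exact DifferentiableAt.const_cpow (by fun_prop) (Or.inl h1)

theorem sum_zetaDiffTerm (N : ℕ) (s : ℂ) :
    ∑ n ∈ Finset.range N, zetaDiffTerm n s =
      (s - 1) * ∑ n ∈ Finset.range N, 1 / (n + 1 : ℂ) ^ s + ((N + 1 : ℝ) : ℂ) ^ (1 - s) - 1 := by
  induction N with
  | zero => simp
  | succ N ih =>
    rw [Finset.sum_range_succ, ih, Finset.sum_range_succ, zetaDiffTerm, Complex.cpow_neg]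
    push_cast
    rw [show (N : ℂ) + 1 + 1 = N + 2 by ring]
    ring

theorem riemannZeta₁_eq_tsum_of_one_lt_re {s : ℂ} (hs : 1 < s.re) :
    riemannZeta₁ s = 1 + ∑' n, zetaDiffTerm n s := by
  have hs1 : s ≠ 1 := by rintro rfl; simp at hs
  have hsum : Summable fun n ↦ zetaDiffTerm n s :=
    Summable.of_norm_bounded ((summable_nat_add_one_rpow (by norm_num)).mul_left _)
      fun n ↦ norm_zetaDiffTerm_le_of_half_le n (by linarith)
  have h1 := hsum.hasSum.tendsto_sum_nat
  have hz : Summable fun n : ℕ ↦ 1 / (n + 1 : ℂ) ^ s := by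
    have := (summable_nat_add_iff 1).mpr (Complex.summable_one_div_nat_cpow.mpr hs)
    simpa using this
  have h2 := hz.hasSum.tendsto_sum_nat
  rw [← zeta_eq_tsum_one_div_nat_add_one_cpow hs] at h2
  have h3 : Tendsto (fun N : ℕ ↦ ((N + 1 : ℝ) : ℂ) ^ (1 - s)) atTop (nhds 0) := by
    rw [tendsto_zero_iff_norm_tendsto_zero]
    have h4 : Tendsto (fun N : ℕ ↦ (N + 1 : ℝ) ^ (-(s.re - 1))) atTop (nhds 0) :=
      (tendsto_rpow_neg_atTop (by linarith : 0 < s.re - 1)).comp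
        (tendsto_atTop_add_const_right _ _ tendsto_natCast_atTop_atTop)
    refine h4.congr fun N ↦ ?_
    rw [Complex.norm_cpow_eq_rpow_re_of_pos (by positivity)]
    simp
  have h5 := ((h2.const_mul (s - 1)).add h3).sub_const 1
  have h6 := tendsto_nhds_unique (h1.congr fun N ↦ sum_zetaDiffTerm N s) h5
  rw [h6, riemannZeta_eq_inv_sub_mul hs1]
  have : s - 1 ≠ 0 := sub_ne_zero.mpr hs1
  field_simp
  ring

theorem riemannZeta₁_eq_tsum {s : ℂ} (hs : 1 / 2 < s.re) :
    riemannZeta₁ s = 1 + ∑' n, zetaDiffTerm n s := by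
  set U : Set ℂ := {z | 1 / 2 < z.re} ∩ Metric.ball 0 (‖s‖ + 3) with hU
  have hUo : IsOpen U := (isOpen_lt continuous_const Complex.continuous_re).inter Metric.isOpen_ball
  have hUc : IsPreconnected U :=
    ((convex_halfSpace_re_gt _).inter (convex_ball _ _)).isPreconnected
  have hd : DifferentiableOn ℂ (fun z ↦ 1 + ∑' n, zetaDiffTerm n z) U := by
    refine (differentiableOn_const _).add (Complex.differentiableOn_tsum_of_summable_norm
      (u := fun n : ℕ ↦ ((‖s‖ + 3 + 1) * (‖s‖ + 3)) * (n + 1 : ℝ) ^ (-3 / 2 : ℝ))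
      ((summable_nat_add_one_rpow (by norm_num)).mul_left _)
      (fun n ↦ (differentiable_zetaDiffTerm n).differentiableOn) hUo ?_)
    rintro n w ⟨hw1, hw2⟩
    refine (norm_zetaDiffTerm_le_of_half_le n (le_of_lt hw1)).trans ?_
    have hw3 : ‖w‖ ≤ ‖s‖ + 3 := by simpa using (mem_ball_zero_iff.mp hw2).le
    gcongr
    refine (norm_sub_le _ _).trans ?_
    simpa using hw3
  have h2 : (2 : ℂ) ∈ U := by
    refine ⟨by norm_num, ?_⟩
    rw [mem_ball_zero_iff]
    have := norm_nonneg s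
    simp only [Complex.norm_ofNat]
    linarith
  refine (differentiable_riemannZeta₁.differentiableOn.analyticOnNhd hUo
    ).eqOn_of_preconnected_of_eventuallyEq (hd.analyticOnNhd hUo) hUc h2 ?_ ⟨hs, ?_⟩
  · filter_upwards [(isOpen_lt continuous_const Complex.continuous_re).mem_nhds
      (show (1 : ℝ) < (2 : ℂ).re by norm_num)] with z hz
    exact riemannZeta₁_eq_tsum_of_one_lt_re hz
  · rw [mem_ball_zero_iff]; linarith

theorem exists_norm_riemannZeta₁_le :
    ∃ S : ℝ, 0 ≤ S ∧ ∀ s : ℂ, 1 / 2 < s.re → ‖riemannZeta₁ s‖ ≤ 1 + S * (‖s - 1‖ * ‖s‖) := by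
  refine ⟨∑' n : ℕ, (n + 1 : ℝ) ^ (-3 / 2 : ℝ), tsum_nonneg fun n ↦ by positivity, fun s hs ↦ ?_⟩
  rw [riemannZeta₁_eq_tsum hs]
  refine (norm_add_le _ _).trans ?_
  rw [norm_one, mul_comm]
  gcongr
  refine tsum_of_norm_bounded ?_ fun n ↦ norm_zetaDiffTerm_le_of_half_le n hs.le
  exact (summable_nat_add_one_rpow (by norm_num)).hasSum.mul_left _

theorem norm_riemannZeta₁_ge_of_re_eq_two {s : ℂ} (hs : s.re = 2) :
    1 / 3 ≤ ‖riemannZeta₁ s‖ := by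
  have hs1 : s ≠ 1 := by rintro rfl; norm_num at hs
  have hz : Summable fun n : ℕ ↦ 1 / (n + 1 : ℂ) ^ s := by
    have := (summable_nat_add_iff 1).mpr
      (Complex.summable_one_div_nat_cpow.mpr (by rw [hs]; norm_num : 1 < s.re))
    simpa using this
  have h1 : ‖riemannZeta s - 1‖ ≤ π ^ 2 / 6 - 1 := by
    rw [zeta_eq_tsum_one_div_nat_add_one_cpow (by rw [hs]; norm_num), hz.tsum_eq_zero_add]
    simp only [Nat.cast_zero, zero_add, one_cpow, div_one, add_sub_cancel_left]
    have hb : HasSum (fun n : ℕ ↦ 1 / ((n + 2 : ℕ) : ℝ) ^ 2) (π ^ 2 / 6 - 1) := by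
      have := (hasSum_nat_add_iff' 2).mpr hasSum_zeta_two
      simpa [Finset.sum_range_succ] using this
    refine tsum_of_norm_bounded hb fun n ↦ ?_
    rw [norm_div, norm_one]
    have : ((n + 1 : ℕ) : ℂ) + 1 = ((n + 2 : ℝ) : ℂ) := by push_cast; ring
    rw [this, Complex.norm_cpow_eq_rpow_re_of_pos (by positivity), hs]
    norm_num
  have h2 : 1 / 3 ≤ ‖riemannZeta s‖ := by
    have h3 := norm_sub_norm_le (1 : ℂ) (riemannZeta s)
    rw [norm_sub_rev, norm_one] at h3
    have h4 : π ^ 2 < 10 := by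
      have := Real.pi_lt_d2
      have := Real.pi_pos
      nlinarith
    linarith
  have h3 : 1 ≤ ‖s - 1‖ := by
    refine le_trans ?_ (Complex.re_le_norm _)
    simp [hs]; norm_num
  have h4 : riemannZeta₁ s = (s - 1) * riemannZeta s := by
    rw [riemannZeta_eq_inv_sub_mul hs1, mul_inv_cancel_left₀ (sub_ne_zero.mpr hs1)]
  rw [h4, norm_mul]
  nlinarith

theorem riemannZeta₁_ne_zero_of_half_lt_re
    (hRH : ∀ s : ℂ, 0 < s.re → s.re < 1 → riemannZeta s = 0 → s.re = 1 / 2)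
    {s : ℂ} (hs : 1 / 2 < s.re) : riemannZeta₁ s ≠ 0 := by
  by_cases hs1 : s = 1
  · simp [hs1]
  intro h
  have hz : riemannZeta s = 0 := by rw [riemannZeta_eq_inv_sub_mul hs1, h, mul_zero]
  rcases lt_or_ge s.re 1 with h1 | h1
  · linarith [hRH s (by linarith) h1 hz]
  · exact riemannZeta_ne_zero_of_one_le_re h1 hz

theorem exists_norm_logDeriv_riemannZeta₁_le
    (hRH : ∀ s : ℂ, 0 < s.re → s.re < 1 → riemannZeta s = 0 → s.re = 1 / 2) :
    ∃ C : ℝ, 0 ≤ C ∧ ∀ s : ℂ, 3 / 5 ≤ s.re → s.re ≤ 3 →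
      ‖deriv riemannZeta₁ s / riemannZeta₁ s‖ ≤ C * (1 + s.im ^ 2) := by
  obtain ⟨S, hS, hbound⟩ := exists_norm_riemannZeta₁_le
  set K : ℝ := 2 * ((29 / 20 + 7 / 5) / 2) / ((29 / 20 - 7 / 5) / 2) ^ 2 with hK
  have hK0 : 0 ≤ K := by rw [hK]; norm_num
  refine ⟨K * (3 * (1 + 50 * S) + 1), by positivity, fun s hs1 hs2 ↦ ?_⟩
  set c : ℂ := ⟨2, s.im⟩ with hc
  have hball : ∀ z ∈ Metric.ball c (29 / 20), 1 / 2 < z.re ∧ ‖z - 1‖ ≤ 3 + |s.im| ∧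
      ‖z‖ ≤ 4 + |s.im| := by
    intro z hz
    rw [mem_ball_iff_norm] at hz
    have h1 := (abs_le.mp ((Complex.abs_re_le_norm (z - c)).trans hz.le)).1
    rw [sub_re, hc] at h1
    have h2 : ‖c - 1‖ ≤ 1 + |s.im| := by
      refine (Complex.norm_le_abs_re_add_abs_im _).trans ?_
      simp only [hc, sub_re, sub_im, one_re, one_im, sub_zero]
      norm_num
    have h3 : ‖z - 1‖ ≤ 3 + |s.im| := by
      have := norm_sub_le_norm_sub_add_norm_sub z c 1
      linarith
    refine ⟨by simp only at h1; linarith, h3, ?_⟩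
    have := norm_sub_le_norm_sub_add_norm_sub z 1 0
    simp only [sub_zero, norm_one] at this
    linarith
  set B : ℝ := 3 * (1 + 50 * S) * (1 + s.im ^ 2) + 1 with hB
  have hB1 : 1 < B := by rw [hB]; have : 0 < 3 * (1 + 50 * S) * (1 + s.im ^ 2) := by positivity
                         linarith
  have hcn : 1 / 3 ≤ ‖riemannZeta₁ c‖ := norm_riemannZeta₁_ge_of_re_eq_two (by simp [hc])
  have key := norm_logDeriv_le_of_norm_le (f := riemannZeta₁) (c := c) (r := 7 / 5) (R := 29 / 20)
    (B := B) (by norm_num) (by norm_num) hB1 differentiable_riemannZeta₁.differentiableOn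
    (fun z hz ↦ riemannZeta₁_ne_zero_of_half_lt_re hRH (hball z hz).1) ?_ (z := s) ?_
  · refine key.trans ?_
    have hlog : Real.log B ≤ B - 1 := Real.log_le_sub_one_of_pos (by linarith)
    have : 2 * Real.log B * ((29 / 20 + 7 / 5) / 2) / ((29 / 20 - 7 / 5) / 2) ^ 2
      = K * Real.log B := by rw [hK]; ring
    rw [this, mul_assoc]
    gcongr
    refine hlog.trans ?_
    rw [hB]
    nlinarith [sq_nonneg s.im]
  · intro z hz
    obtain ⟨h1, h2, h3⟩ := hball z hz
    refine (hbound z h1).trans ?_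
    have h4 : ‖z - 1‖ * ‖z‖ ≤ 50 * (1 + s.im ^ 2) := by
      have : ‖z - 1‖ * ‖z‖ ≤ (3 + |s.im|) * (4 + |s.im|) := by gcongr
      nlinarith [sq_abs s.im, sq_nonneg (|s.im| - 1)]
    have h5 : 1 + S * (‖z - 1‖ * ‖z‖) ≤ (1 + 50 * S) * (1 + s.im ^ 2) := by
      have : S * (‖z - 1‖ * ‖z‖) ≤ S * (50 * (1 + s.im ^ 2)) := by gcongr
      nlinarith [sq_nonneg s.im]
    refine h5.trans ?_
    have : B * (1 / 3) ≤ B * ‖riemannZeta₁ c‖ := by gcongr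
    refine le_trans ?_ this
    rw [hB]
    linarith
  · have h1 : s - c = ((s.re - 2 : ℝ) : ℂ) := by
      apply Complex.ext <;> simp [hc]
    rw [h1, Complex.norm_real, Real.norm_eq_abs, abs_le]
    constructor <;> linarith

theorem mellinC_eq_mellin (Φ : ℝ → ℝ) (s : ℂ) : mellinC Φ s = mellin (fun x ↦ (Φ x : ℂ)) s := by
  simp only [mellinC, mellin, smul_eq_mul, mul_comm]

theorem isBigO_rpow_of_hasCompactSupport {Φ : ℝ → ℝ} (hc : HasCompactSupport Φ) (a : ℝ) :
    (fun x ↦ (Φ x : ℂ)) =O[atTop] fun x : ℝ ↦ x ^ (-a) := by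
  obtain ⟨R, hR⟩ := hc.isCompact.isBounded.subset_closedBall 0
  refine (isBigO_zero (E' := ℂ) _ _).congr' ?_ EventuallyEq.rfl
  filter_upwards [eventually_gt_atTop R, eventually_gt_atTop 0] with x hx hx0
  have : x ∉ tsupport Φ := fun h ↦ by
    have := hR h
    rw [mem_closedBall_zero_iff, Real.norm_eq_abs, abs_of_pos hx0] at this
    linarith
  simp [image_eq_zero_of_notMem_tsupport this]

theorem isBigO_rpow_zero_of_continuous {Φ : ℝ → ℝ} (h : Continuous Φ) :
    (fun x ↦ (Φ x : ℂ)) =O[nhdsWithin 0 (Set.Ioi 0)] fun x : ℝ ↦ x ^ (-(0 : ℝ)) := by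
  simp only [neg_zero, Real.rpow_zero]
  exact ((Complex.continuous_ofReal.comp h).continuousAt.isBigO_one ℝ).mono nhdsWithin_le_nhds

theorem locallyIntegrableOn_ofReal_comp {Φ : ℝ → ℝ} (h : Continuous Φ) :
    LocallyIntegrableOn (fun x ↦ (Φ x : ℂ)) (Set.Ioi 0) :=
  (Complex.continuous_ofReal.comp h).locallyIntegrable.locallyIntegrableOn _

theorem differentiableAt_mellinC {Φ : ℝ → ℝ} (h : Continuous Φ) (hc : HasCompactSupport Φ)
    {s : ℂ} (hs : 0 < s.re) : DifferentiableAt ℂ (mellinC Φ) s := by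
  rw [funext (mellinC_eq_mellin Φ)]
  exact mellin_differentiableAt_of_isBigO_rpow (locallyIntegrableOn_ofReal_comp h)
    (isBigO_rpow_of_hasCompactSupport hc (s.re + 1)) (by linarith)
    (isBigO_rpow_zero_of_continuous h) hs

theorem mellinConvergent_of_hasCompactSupport {Φ : ℝ → ℝ} (h : Continuous Φ)
    (hc : HasCompactSupport Φ) {s : ℂ} (hs : 0 < s.re) :
    MellinConvergent (fun x ↦ (Φ x : ℂ)) s :=
  mellinConvergent_of_isBigO_rpow (locallyIntegrableOn_ofReal_comp h)
    (isBigO_rpow_of_hasCompactSupport hc (s.re + 1)) (by linarith)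
    (isBigO_rpow_zero_of_continuous h) hs

theorem mellinC_eq_neg_inv_mul_mellinC_deriv {Φ : ℝ → ℝ} (h : ContDiff ℝ 1 Φ)
    (hc : HasCompactSupport Φ) {s : ℂ} (hs : 0 < s.re) :
    mellinC Φ s = -(s⁻¹ * mellinC (deriv Φ) (s + 1)) := by
  have hs0 : s ≠ 0 := by rintro rfl; simp at hs
  have hcd : HasCompactSupport (deriv Φ) := hc.deriv
  have i1 := mellinConvergent_of_hasCompactSupport h.continuous hc hs
  have i2 := mellinConvergent_of_hasCompactSupport (h.continuous_deriv le_rfl) hcd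
    (s := s + 1) (by simp; linarith)
  simp only [MellinConvergent, smul_eq_mul, add_sub_cancel_right] at i1 i2
  have hF : ∀ x ∈ Set.Ioi (0 : ℝ), HasDerivAt (fun x : ℝ ↦ (Φ x : ℂ) * ((x : ℂ) ^ s / s))
      (s⁻¹ * ((x : ℂ) ^ s * ((deriv Φ x : ℝ) : ℂ)) + (x : ℂ) ^ (s - 1) * (Φ x : ℂ)) x := by
    intro x hx
    have d1 : HasDerivAt (fun x ↦ (Φ x : ℂ)) ((deriv Φ x : ℝ) : ℂ) x :=
      ((h.differentiable one_ne_zero).differentiableAt.hasDerivAt (x := x)).ofReal_comp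
    have d2 := (hasDerivAt_ofReal_cpow_const (ne_of_gt hx) hs0).div_const s
    refine (d1.mul d2).congr_deriv ?_
    field_simp
  have hcont : ContinuousWithinAt (fun x : ℝ ↦ (Φ x : ℂ) * ((x : ℂ) ^ s / s)) (Set.Ici 0) 0 := by
    refine ContinuousAt.continuousWithinAt ?_
    exact (Complex.continuous_ofReal.comp h.continuous).continuousAt.mul
      ((Complex.continuousAt_ofReal_cpow_const 0 s (Or.inl hs)).div_const s)
  have htop : Tendsto (fun x : ℝ ↦ (Φ x : ℂ) * ((x : ℂ) ^ s / s)) atTop (nhds 0) := by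
    refine tendsto_const_nhds.congr' ?_
    obtain ⟨R, hR⟩ := hc.isCompact.isBounded.subset_closedBall 0
    filter_upwards [eventually_gt_atTop R, eventually_gt_atTop 0] with x hx hx0
    have : x ∉ tsupport Φ := fun h ↦ by
      have := hR h
      rw [mem_closedBall_zero_iff, Real.norm_eq_abs, abs_of_pos hx0] at this
      linarith
    simp [image_eq_zero_of_notMem_tsupport this]
  have key := integral_Ioi_of_hasDerivAt_of_tendsto hcont hF ((i2.const_mul s⁻¹).add i1) htop
  rw [integral_add (i2.const_mul s⁻¹) i1, integral_const_mul] at key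
  simp only [ofReal_zero, zero_cpow hs0, zero_div, mul_zero, sub_zero] at key
  simp only [mellinC, add_sub_cancel_right, mul_comm (ofReal _)]
  linear_combination key

theorem exists_norm_mellinC_le {Φ : ℝ → ℝ} (h : Continuous Φ) (hc : HasCompactSupport Φ)
    {a b : ℝ} (ha : 0 < a) (hab : a ≤ b) :
    ∃ C : ℝ, ∀ s : ℂ, a ≤ s.re → s.re ≤ b → ‖mellinC Φ s‖ ≤ C := by
  have ia := (mellinConvergent_of_hasCompactSupport h hc (s := a) (by simpa)).norm
  have ib := (mellinConvergent_of_hasCompactSupport h hc (s := b) (by simp; linarith)).norm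
  refine ⟨∫ x in Set.Ioi (0 : ℝ), (‖(x : ℂ) ^ ((a : ℂ) - 1) • (Φ x : ℂ)‖ +
    ‖(x : ℂ) ^ ((b : ℂ) - 1) • (Φ x : ℂ)‖), fun s hsa hsb ↦ ?_⟩
  refine norm_integral_le_of_norm_le (ia.add ib) ?_
  filter_upwards [ae_restrict_mem measurableSet_Ioi] with x hx
  have hx : 0 < x := hx
  simp only [norm_smul, norm_mul, Complex.norm_cpow_eq_rpow_re_of_pos hx, sub_re, one_re,
    ofReal_re]
  rw [mul_comm, ← add_mul]
  gcongr
  rcases le_total x 1 with h1 | h1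
  · have := Real.rpow_le_rpow_of_exponent_ge hx h1 (by linarith : a - 1 ≤ s.re - 1)
    have := Real.rpow_nonneg hx.le (b - 1)
    linarith
  · have := Real.rpow_le_rpow_of_exponent_le h1 (by linarith : s.re - 1 ≤ b - 1)
    have := Real.rpow_nonneg hx.le (a - 1)
    linarith

theorem exists_norm_mellinC_mul_pow_le (k : ℕ) {Φ : ℝ → ℝ} (h : ContDiff ℝ (⊤ : ℕ∞) Φ)
    (hc : HasCompactSupport Φ) {a b : ℝ} (ha : 0 < a) (hab : a ≤ b) :
    ∃ C : ℝ, ∀ s : ℂ, a ≤ s.re → s.re ≤ b → ‖mellinC Φ s‖ * ‖s‖ ^ k ≤ C := by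
  induction k generalizing Φ a b with
  | zero => simpa using exists_norm_mellinC_le h.continuous hc ha hab
  | succ k ih =>
    have h' : ContDiff ℝ (⊤ : ℕ∞) (deriv Φ) := (contDiff_infty_iff_deriv.mp h).2
    obtain ⟨C, hC⟩ := ih h' hc.deriv (a := a + 1) (b := b + 1) (by linarith) (by linarith)
    refine ⟨C, fun s hsa hsb ↦ le_trans ?_
      (hC (s + 1) (by simp; linarith) (by simp; linarith))⟩
    have hs0 : s ≠ 0 := by rintro rfl; simp at hsa; linarith
    have hle : ‖s‖ ≤ ‖s + 1‖ := by
      rw [Complex.norm_def, Complex.norm_def]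
      apply Real.sqrt_le_sqrt
      simp only [normSq_apply, add_re, add_im, one_re, one_im]
      nlinarith
    rw [mellinC_eq_neg_inv_mul_mellinC_deriv (h.of_le (by exact_mod_cast le_top)) hc
      (ha.trans_le hsa), norm_neg, norm_mul, norm_inv]
    have : ‖s‖⁻¹ * ‖mellinC (deriv Φ) (s + 1)‖ * ‖s‖ ^ (k + 1)
        = ‖mellinC (deriv Φ) (s + 1)‖ * ‖s‖ ^ k := by
      have := norm_ne_zero_iff.mpr hs0
      field_simp
      ring
    rw [this]
    gcongr

theorem exists_norm_le_inv_one_add_sq {G : ℂ → ℂ} {a b C : ℝ}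
    (hd : ContinuousOn G {z | a ≤ z.re ∧ z.re ≤ b})
    (hC : ∀ z : ℂ, a ≤ z.re → z.re ≤ b → 1 ≤ |z.im| → ‖G z‖ ≤ C / z.im ^ 2) :
    ∃ K : ℝ, 0 ≤ K ∧ ∀ z : ℂ, a ≤ z.re → z.re ≤ b → ‖G z‖ ≤ K * (1 + z.im ^ 2)⁻¹ := by
  obtain ⟨D, hD⟩ := (isCompact_Icc.reProdIm isCompact_Icc).exists_bound_of_continuousOn
    (hd.mono fun z (hz : z ∈ Set.Icc a b ×ℂ Set.Icc (-1) 1) ↦ hz.1)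
  refine ⟨2 * (|C| + |D|), by positivity, fun z ha hb ↦ ?_⟩
  rcases le_total 1 |z.im| with h | h
  · refine (hC z ha hb h).trans ?_
    have h1 : 1 ≤ z.im ^ 2 := by rw [← sq_abs]; nlinarith
    rw [← div_eq_mul_inv, div_le_div_iff₀ (by positivity) (by positivity)]
    have : C ≤ |C| := le_abs_self C
    nlinarith [mul_nonneg (abs_nonneg C) (sub_nonneg.mpr h1), mul_nonneg (abs_nonneg D)
      (sq_nonneg z.im), mul_nonneg (sub_nonneg.mpr this) (sq_nonneg z.im)]
  · have h1 : z.im ^ 2 ≤ 1 := by rw [← sq_abs]; nlinarith [abs_nonneg z.im]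
    refine (hD z ⟨⟨ha, hb⟩, abs_le.mp h⟩).trans ?_
    rw [← div_eq_mul_inv, le_div_iff₀ (by positivity)]
    have : D ≤ |D| := le_abs_self D
    nlinarith [abs_nonneg C, abs_nonneg D, mul_nonneg (abs_nonneg D) (sub_nonneg.mpr h1),
      mul_nonneg (sub_nonneg.mpr this) (sq_nonneg z.im)]

theorem integrable_vertical_of_continuousOn {G : ℂ → ℂ} {a b C : ℝ}
    (hd : ContinuousOn G {z | a ≤ z.re ∧ z.re ≤ b})
    (hC : ∀ z : ℂ, a ≤ z.re → z.re ≤ b → 1 ≤ |z.im| → ‖G z‖ ≤ C / z.im ^ 2)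
    {c : ℝ} (hac : a ≤ c) (hcb : c ≤ b) : Integrable fun t : ℝ ↦ G (c + t * Complex.I) := by
  obtain ⟨K, -, hK⟩ := exists_norm_le_inv_one_add_sq hd hC
  refine Integrable.mono' (integrable_inv_one_add_sq.const_mul K)
    (Continuous.aestronglyMeasurable ?_) (Eventually.of_forall fun t ↦ ?_)
  · exact hd.comp_continuous (by fun_prop) fun t ↦ by simp [hac, hcb]
  · simpa using hK (c + t * Complex.I) (by simpa) (by simpa)

/-- Shifting a vertical contour for a function holomorphic in a closed strip with quadratic
decay. -/
theorem integral_vertical_eq_of_differentiableOn {G : ℂ → ℂ} {a b C : ℝ} (hab : a ≤ b)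
    (hd : DifferentiableOn ℂ G {z | a ≤ z.re ∧ z.re ≤ b})
    (hC : ∀ z : ℂ, a ≤ z.re → z.re ≤ b → 1 ≤ |z.im| → ‖G z‖ ≤ C / z.im ^ 2) :
    ∫ t : ℝ, G (a + t * Complex.I) = ∫ t : ℝ, G (b + t * Complex.I) := by
  obtain ⟨K, hK0, hK⟩ := exists_norm_le_inv_one_add_sq hd.continuousOn hC
  have lim : ∀ c : ℝ, a ≤ c → c ≤ b → Tendsto (fun T : ℝ ↦ ∫ t in (-T)..T, G (c + t * Complex.I))
      atTop (nhds (∫ t : ℝ, G (c + t * Complex.I))) := fun c h1 h2 ↦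
    intervalIntegral_tendsto_integral (integrable_vertical_of_continuousOn hd.continuousOn hC h1 h2)
      tendsto_neg_atTop_atBot tendsto_id
  have hdecay : Tendsto (fun T : ℝ ↦ K * (1 + T ^ 2)⁻¹ * |b - a|) atTop (nhds 0) := by
    have : Tendsto (fun T : ℝ ↦ (1 + T ^ 2)⁻¹) atTop (nhds 0) :=
      (tendsto_atTop_add_const_left _ _ (tendsto_pow_atTop two_ne_zero)).inv_tendsto_atTop
    simpa using (this.const_mul K).mul_const |b - a|
  have horiz : ∀ σ : ℝ, (σ = 1 ∨ σ = -1) → Tendsto (fun T : ℝ ↦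
      ∫ x in a..b, G (x + ((σ * T : ℝ) : ℂ) * Complex.I)) atTop (nhds 0) := by
    intro σ hσ
    refine squeeze_zero_norm (fun T ↦ ?_) hdecay
    refine intervalIntegral.norm_integral_le_of_norm_le_const fun x hx ↦ ?_
    rw [Set.uIoc_of_le hab] at hx
    have := hK (x + ((σ * T : ℝ) : ℂ) * Complex.I) (by simpa using hx.1.le) (by simpa using hx.2)
    refine this.trans (le_of_eq ?_)
    rcases hσ with rfl | rfl <;> simp
  have hrect : ∀ T : ℝ, (∫ x in a..b, G (x + ((-1 * T : ℝ) : ℂ) * Complex.I))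
      - (∫ x in a..b, G (x + ((1 * T : ℝ) : ℂ) * Complex.I))
      + Complex.I * (∫ t in (-T)..T, G (b + t * Complex.I))
      - Complex.I * (∫ t in (-T)..T, G (a + t * Complex.I)) = 0 := by
    intro T
    have := Complex.integral_boundary_rect_eq_zero_of_differentiableOn G ⟨a, -T⟩ ⟨b, T⟩
      (hd.mono fun z hz ↦ by simpa [Set.uIcc_of_le hab] using hz.1)
    simpa using this
  have hlim := (((horiz (-1) (Or.inr rfl)).sub (horiz 1 (Or.inl rfl))).add
    ((lim b hab le_rfl).const_mul Complex.I)).sub ((lim a le_rfl hab).const_mul Complex.I)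
  have h0 := tendsto_nhds_unique (hlim.congr hrect) tendsto_const_nhds
  have h1 : Complex.I * ((∫ t : ℝ, G (b + t * Complex.I)) - ∫ t : ℝ, G (a + t * Complex.I)) = 0 := by
    linear_combination h0
  exact (sub_eq_zero.mp ((mul_eq_zero.mp h1).resolve_left Complex.I_ne_zero)).symm

theorem inv_sq_add_sq_eq {c : ℝ} (hc : c ≠ 0) (t : ℝ) :
    (c ^ 2 + t ^ 2)⁻¹ = (c ^ 2)⁻¹ * (1 + (c⁻¹ * t) ^ 2)⁻¹ := by
  rw [← mul_inv]
  congr 1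
  field_simp

theorem integrable_inv_sq_add_sq {c : ℝ} (hc : c ≠ 0) :
    Integrable fun t : ℝ ↦ (c ^ 2 + t ^ 2)⁻¹ := by
  simp_rw [inv_sq_add_sq_eq hc]
  exact (integrable_inv_one_add_sq.comp_mul_left' (inv_ne_zero hc)).const_mul _

theorem integral_univ_inv_sq_add_sq {c : ℝ} (hc : c ≠ 0) :
    ∫ t : ℝ, (c ^ 2 + t ^ 2)⁻¹ = π / |c| := by
  simp_rw [inv_sq_add_sq_eq hc]
  rw [integral_const_mul, Measure.integral_comp_mul_left (fun x ↦ (1 + x ^ 2)⁻¹),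
    integral_univ_inv_one_add_sq, inv_inv, smul_eq_mul, ← sq_abs]
  have := abs_ne_zero.mpr hc
  field_simp

theorem ofReal_add_mul_I_ne_zero {c : ℝ} (hc : c ≠ 0) (t : ℝ) : (c + t * Complex.I : ℂ) ≠ 0 := by
  intro h
  apply hc
  simpa using congr_arg Complex.re h

theorem norm_ofReal_add_mul_I_sq (c t : ℝ) : ‖(c + t * Complex.I : ℂ)‖ ^ 2 = c ^ 2 + t ^ 2 := by
  rw [← Complex.normSq_eq_norm_sq, Complex.normSq_add_mul_I]

theorem integrable_inv_mul_add_one {c : ℝ} (hc : c ≠ 0) (hc1 : c + 1 ≠ 0) :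
    Integrable fun t : ℝ ↦ ((c + t * Complex.I : ℂ) * (c + t * Complex.I + 1))⁻¹ := by
  have e : ∀ t : ℝ, (c + t * Complex.I + 1 : ℂ) = ((c + 1 : ℝ) : ℂ) + t * Complex.I := by
    intro t; push_cast; ring
  refine Integrable.mono' ((integrable_inv_sq_add_sq hc).add (integrable_inv_sq_add_sq hc1))
    (Continuous.aestronglyMeasurable ?_) (Eventually.of_forall fun t ↦ ?_)
  · refine Continuous.inv₀ (by fun_prop) fun t ↦ mul_ne_zero (ofReal_add_mul_I_ne_zero hc t) ?_
    rw [e]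
    exact ofReal_add_mul_I_ne_zero hc1 t
  · rw [e, norm_inv, norm_mul, mul_inv, Pi.add_apply, ← norm_ofReal_add_mul_I_sq,
      ← norm_ofReal_add_mul_I_sq, ← inv_pow, ← inv_pow]
    nlinarith [sq_nonneg (‖(c + t * Complex.I : ℂ)‖⁻¹ -
      ‖(((c + 1 : ℝ) : ℂ) + t * Complex.I : ℂ)‖⁻¹), sq_nonneg (‖(c + t * Complex.I : ℂ)‖⁻¹),
      sq_nonneg (‖(((c + 1 : ℝ) : ℂ) + t * Complex.I : ℂ)‖⁻¹)]

theorem inv_mul_add_inv_mul_eq {c d u v u' v' : ℂ} (hu : u ≠ 0) (hv : v ≠ 0) (hu' : u' ≠ 0)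
    (hv' : v' ≠ 0) (h1 : u' = u + 1) (h2 : v' = v + 1) (hc : 2 * c = u + v)
    (hd : 2 * d = u' + v') :
    (u * u')⁻¹ + (v * v')⁻¹ = 2 * (c * (u * v)⁻¹ - d * (u' * v')⁻¹) := by
  obtain rfl : c = (u + v) / 2 := by rw [← hc]; ring
  obtain rfl : d = (u' + v') / 2 := by rw [← hd]; ring
  field_simp
  subst h1 h2
  ring

theorem integral_inv_mul_add_one {c : ℝ} (hc : c ≠ 0) (hc1 : c + 1 ≠ 0) :
    ∫ t : ℝ, ((c + t * Complex.I : ℂ) * (c + t * Complex.I + 1))⁻¹ =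
      ((c * (π / |c|) - (c + 1) * (π / |c + 1|) : ℝ) : ℂ) := by
  set f : ℝ → ℂ := fun t ↦ ((c + t * Complex.I : ℂ) * (c + t * Complex.I + 1))⁻¹ with hf
  have hfi : Integrable f := integrable_inv_mul_add_one hc hc1
  have h1 : ∫ t, f (-t) = ∫ t, f t := integral_neg_eq_self f volume
  have h2 : ∫ t, (f t + f (-t)) = (∫ t, f t) + ∫ t, f (-t) := integral_add hfi hfi.comp_neg
  have h3 : ∀ t, f t + f (-t) =
      ((2 * (c * (c ^ 2 + t ^ 2)⁻¹ - (c + 1) * ((c + 1) ^ 2 + t ^ 2)⁻¹) : ℝ) : ℂ) := by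
    intro t
    have n1 := ofReal_add_mul_I_ne_zero hc t
    have n2 := ofReal_add_mul_I_ne_zero hc (-t)
    have n3 := ofReal_add_mul_I_ne_zero hc1 t
    have n4 := ofReal_add_mul_I_ne_zero hc1 (-t)
    have p1 : ((c : ℂ) ^ 2 + (t : ℂ) ^ 2) = (c + t * Complex.I) * (c + (-t : ℝ) * Complex.I) := by
      push_cast
      linear_combination (t : ℂ) ^ 2 * Complex.I_sq
    have p2 : (((c : ℂ) + 1) ^ 2 + (t : ℂ) ^ 2) =
        (((c + 1 : ℝ) : ℂ) + t * Complex.I) * (((c + 1 : ℝ) : ℂ) + (-t : ℝ) * Complex.I) := by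
      push_cast
      linear_combination (t : ℂ) ^ 2 * Complex.I_sq
    have e : ∀ t : ℝ, (c + t * Complex.I + 1 : ℂ) = ((c + 1 : ℝ) : ℂ) + t * Complex.I := by
      intro t; push_cast; ring
    simp only [hf, e]
    have p3 : ((2 * (c * (c ^ 2 + t ^ 2)⁻¹ - (c + 1) * ((c + 1) ^ 2 + t ^ 2)⁻¹) : ℝ) : ℂ) =
        2 * (c * ((c : ℂ) ^ 2 + (t : ℂ) ^ 2)⁻¹
          - (c + 1) * (((c : ℂ) + 1) ^ 2 + (t : ℂ) ^ 2)⁻¹) := by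
      push_cast; ring
    rw [p3, p1, p2]
    rw [show ((-t : ℝ) : ℂ) = -t by push_cast; rfl] at n2 n4 ⊢
    exact inv_mul_add_inv_mul_eq n1 n2 n3 n4 (by push_cast; ring) (by push_cast; ring) (by ring)
      (by push_cast; ring)
  have h4 : ∫ t, (f t + f (-t)) =
      ((2 * (c * (π / |c|) - (c + 1) * (π / |c + 1|)) : ℝ) : ℂ) := by
    simp_rw [h3]
    rw [integral_complex_ofReal, integral_const_mul,
      integral_sub ((integrable_inv_sq_add_sq hc).const_mul _)
      ((integrable_inv_sq_add_sq hc1).const_mul _), integral_const_mul, integral_const_mul,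
      integral_univ_inv_sq_add_sq hc, integral_univ_inv_sq_add_sq hc1]
  rw [h4, h1] at h2
  push_cast at h2 ⊢
  linear_combination -h2 / 2

theorem logDeriv_riemannZeta_one_add_eq {α : ℂ} (h0 : α ≠ 0) (h : riemannZeta₁ (1 + 2 * α) ≠ 0) :
    deriv riemannZeta (1 + 2 * α) / riemannZeta (1 + 2 * α) =
      deriv riemannZeta₁ (1 + 2 * α) / riemannZeta₁ (1 + 2 * α) - (2 * α)⁻¹ := by
  have hs : 1 + 2 * α ≠ 1 := by simpa using h0
  rw [deriv_riemannZeta_eq_neg_inv_sub_sq_mul_add hs, riemannZeta_eq_inv_sub_mul hs,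
    show 1 + 2 * α - 1 = 2 * α by ring]
  field_simp
  ring

theorem rpow_le_rpow_add_rpow {X x a b : ℝ} (hX : 0 < X) (ha : a ≤ x) (hb : x ≤ b) :
    X ^ x ≤ X ^ a + X ^ b := by
  rcases le_total 1 X with h | h
  · exact (rpow_le_rpow_of_exponent_le h hb).trans (by linarith [rpow_nonneg hX.le a])
  · exact (rpow_le_rpow_of_exponent_ge hX h ha).trans (by linarith [rpow_nonneg hX.le b])

theorem isOpen_setOf_lt_re (a : ℝ) : IsOpen {z : ℂ | a < z.re} :=
  isOpen_lt continuous_const Complex.continuous_re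

theorem differentiableOn_logDeriv_riemannZeta₁_one_add
    (hRH : ∀ s : ℂ, 0 < s.re → s.re < 1 → riemannZeta s = 0 → s.re = 1 / 2) :
    DifferentiableOn ℂ (fun α ↦ deriv riemannZeta₁ (1 + 2 * α) / riemannZeta₁ (1 + 2 * α))
      {z | -1 / 4 < z.re} := by
  have h1 : Differentiable ℂ (deriv riemannZeta₁) := fun z ↦
    (differentiable_riemannZeta₁.analyticAt z).deriv.differentiableAt
  intro z (hz : -1 / 4 < z.re)
  refine DifferentiableAt.differentiableWithinAt (DifferentiableAt.div ?_ ?_ ?_)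
  · exact (h1 _).comp z (by fun_prop)
  · exact (differentiable_riemannZeta₁ _).comp z (by fun_prop)
  · refine riemannZeta₁_ne_zero_of_half_lt_re hRH ?_
    simp
    linarith

/-- The holomorphic function in `-1 / 4 < re α` which, away from `α = 0`, differs from
`(deriv ζ / ζ)(1 + 2 α) M(α) X ^ α` by a multiple of `(α (α + 1))⁻¹`. -/
def shiftedIntegrand (M : ℂ → ℂ) (X : ℝ) (α : ℂ) : ℂ :=
  deriv riemannZeta₁ (1 + 2 * α) / riemannZeta₁ (1 + 2 * α) * (M α * (X : ℂ) ^ α) -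
    1 / 2 * dslope (fun z ↦ M z * (X : ℂ) ^ z - M 0 / (z + 1)) 0 α

theorem shiftedIntegrand_of_ne_zero (M : ℂ → ℂ) (X : ℝ) {α : ℂ} (h0 : α ≠ 0) :
    shiftedIntegrand M X α =
      deriv riemannZeta₁ (1 + 2 * α) / riemannZeta₁ (1 + 2 * α) * (M α * (X : ℂ) ^ α) -
        (2 * α)⁻¹ * (M α * (X : ℂ) ^ α) + M 0 / 2 * (α * (α + 1))⁻¹ := by
  rw [shiftedIntegrand, dslope_of_ne _ h0, slope_def_field]
  simp only [cpow_zero, mul_one, zero_add, div_one, sub_self, sub_zero, mul_inv]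
  field_simp
  ring

theorem differentiableOn_shiftedIntegrand
    (hRH : ∀ s : ℂ, 0 < s.re → s.re < 1 → riemannZeta s = 0 → s.re = 1 / 2)
    {M : ℂ → ℂ} (hM : DifferentiableOn ℂ M {z | -1 / 4 < z.re}) {X : ℝ} (hX : 0 < X) :
    DifferentiableOn ℂ (shiftedIntegrand M X) {z | -1 / 4 < z.re} := by
  have hX' : (X : ℂ) ≠ 0 := by exact_mod_cast hX.ne'
  have hpow : Differentiable ℂ fun z : ℂ ↦ (X : ℂ) ^ z := fun z ↦
    differentiableAt_id.const_cpow (Or.inl hX')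
  have hMX := hM.mul hpow.differentiableOn
  refine ((differentiableOn_logDeriv_riemannZeta₁_one_add hRH).mul hMX).sub
    (DifferentiableOn.const_mul ?_ _)
  rw [Complex.differentiableOn_dslope
    ((isOpen_setOf_lt_re _).mem_nhds (by norm_num : (0 : ℂ) ∈ {z : ℂ | -1 / 4 < z.re}))]
  refine hMX.sub (DifferentiableOn.div (by fun_prop) (by fun_prop) fun z hz h ↦ ?_)
  have h1 := congr_arg Complex.re h
  simp at h1 hz
  linarith

theorem norm_shiftedIntegrand_le {M : ℂ → ℂ} {X A B Y : ℝ} {z : ℂ}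
    (hz : 1 ≤ |z.im|) (hA : ‖deriv riemannZeta₁ (1 + 2 * z) / riemannZeta₁ (1 + 2 * z)‖ ≤
      A * (1 + (2 * z.im) ^ 2)) (hA0 : 0 ≤ A)
    (hB : ‖M z‖ * z.im ^ 4 ≤ B) (hY : ‖(X : ℂ) ^ z‖ ≤ Y) :
    ‖shiftedIntegrand M X z‖ ≤ ((5 * A + 1) * (B * Y) + ‖M 0‖) / z.im ^ 2 := by
  have h1 : 1 ≤ z.im ^ 2 := by rw [← sq_abs]; nlinarith
  have hB0 : 0 ≤ B := le_trans (by positivity) hB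
  have hY0 : 0 ≤ Y := (norm_nonneg _).trans hY
  have hzn : |z.im| ≤ ‖z‖ := Complex.abs_im_le_norm z
  have hzn1 : |z.im| ≤ ‖z + 1‖ := by simpa using Complex.abs_im_le_norm (z + 1)
  have h0 : z ≠ 0 := by
    rintro rfl
    norm_num at hz
  have him : z.im ≠ 0 := fun h ↦ by norm_num [h] at hz
  have hMB : ‖M z‖ ≤ B / z.im ^ 4 := by rwa [le_div_iff₀ (by positivity)]
  have hMX : ‖M z * (X : ℂ) ^ z‖ ≤ B / z.im ^ 4 * Y := by
    rw [norm_mul]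
    gcongr
  rw [shiftedIntegrand_of_ne_zero M X h0]
  have e1 : ‖deriv riemannZeta₁ (1 + 2 * z) / riemannZeta₁ (1 + 2 * z) * (M z * (X : ℂ) ^ z)‖ ≤
      5 * A * (B * Y) / z.im ^ 2 := by
    rw [norm_mul]
    calc _ ≤ (A * (5 * z.im ^ 2)) * (B / z.im ^ 4 * Y) := by
          gcongr
          exact hA.trans (by gcongr; linarith)
      _ = _ := by field_simp
  have e2 : ‖(2 * z)⁻¹ * (M z * (X : ℂ) ^ z)‖ ≤ B * Y / z.im ^ 2 := by
    rw [norm_mul]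
    calc _ ≤ 1 * (B / z.im ^ 4 * Y) := by
          gcongr
          rw [norm_inv]
          refine inv_le_one_of_one_le₀ ?_
          rw [norm_mul, Complex.norm_two]
          linarith
      _ = B * Y / z.im ^ 2 * (z.im ^ 2)⁻¹ := by field_simp
      _ ≤ B * Y / z.im ^ 2 * 1 := by
          gcongr
          exact inv_le_one_of_one_le₀ h1
      _ = _ := mul_one _
  have e3 : ‖M 0 / 2 * (z * (z + 1))⁻¹‖ ≤ ‖M 0‖ / z.im ^ 2 := by
    rw [norm_mul, norm_inv, norm_mul, ← div_eq_mul_inv, norm_div, Complex.norm_two, ← sq_abs]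
    gcongr
    · linarith [norm_nonneg (M 0)]
    · rw [sq]
      gcongr
  calc _ ≤ _ := norm_add_le_of_le (norm_sub_le_of_le e1 e2) e3
    _ = _ := by ring

/-- Shifting the contour of `(deriv ζ / ζ)(1 + 2 α) M(α) X ^ α` to `re α = -1 / 5`. -/
theorem integral_logDeriv_riemannZeta_mul_shift
    (hRH : ∀ s : ℂ, 0 < s.re → s.re < 1 → riemannZeta s = 0 → s.re = 1 / 2)
    {M : ℂ → ℂ} (hM : DifferentiableOn ℂ M {z | -1 / 4 < z.re}) {B : ℝ}
    (hB : ∀ z : ℂ, -1 / 5 ≤ z.re → z.re ≤ 1 / 4 → ‖M z‖ * z.im ^ 4 ≤ B) {X : ℝ} (hX : 0 < X)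
    {ε : ℝ} (hε : ε ∈ Set.Ioo (0 : ℝ) (1 / 4)) :
    (∫ t : ℝ, (fun α ↦ deriv riemannZeta (1 + 2 * α) / riemannZeta (1 + 2 * α) * M α *
        (X : ℂ) ^ α) (ε + t * Complex.I)) =
      (∫ t : ℝ, (fun α ↦ deriv riemannZeta (1 + 2 * α) / riemannZeta (1 + 2 * α) * M α *
        (X : ℂ) ^ α) (((-1 / 5 : ℝ) : ℂ) + t * Complex.I)) - π * M 0 := by
  obtain ⟨A, hA0, hA⟩ := exists_norm_logDeriv_riemannZeta₁_le hRH
  have hd : DifferentiableOn ℂ (shiftedIntegrand M X) {z | -1 / 5 ≤ z.re ∧ z.re ≤ ε} :=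
    (differentiableOn_shiftedIntegrand hRH hM hX).mono fun z hz ↦
      lt_of_lt_of_le (by norm_num) hz.1
  have hC : ∀ z : ℂ, -1 / 5 ≤ z.re → z.re ≤ ε → 1 ≤ |z.im| → ‖shiftedIntegrand M X z‖ ≤
      ((5 * A + 1) * (B * (X ^ (-1 / 5 : ℝ) + X ^ (1 / 4 : ℝ))) + ‖M 0‖) / z.im ^ 2 := by
    intro z h1 h2 h3
    have h2' : z.re ≤ 1 / 4 := h2.trans hε.2.le
    refine norm_shiftedIntegrand_le h3 ?_ hA0 (hB z h1 h2') ?_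
    · have := hA (1 + 2 * z) (by simp; linarith) (by simp; linarith)
      simpa using this
    · rw [Complex.norm_cpow_eq_rpow_re_of_pos hX]
      exact rpow_le_rpow_add_rpow hX h1 h2'
  have key : ∀ c : ℝ, -1 / 5 ≤ c → c ≤ ε → c ≠ 0 →
      (∫ t : ℝ, (fun α ↦ deriv riemannZeta (1 + 2 * α) / riemannZeta (1 + 2 * α) * M α *
        (X : ℂ) ^ α) (c + t * Complex.I)) =
      (∫ t : ℝ, shiftedIntegrand M X (c + t * Complex.I)) -
        M 0 / 2 * ((c * (π / |c|) - (c + 1) * (π / |c + 1|) : ℝ) : ℂ) := by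
    intro c h1 h2 h3
    have hc1 : c + 1 ≠ 0 := by linarith
    rw [← integral_inv_mul_add_one h3 hc1, ← integral_const_mul, ← integral_sub
      (integrable_vertical_of_continuousOn hd.continuousOn hC h1 h2)
      ((integrable_inv_mul_add_one h3 hc1).const_mul _)]
    refine integral_congr_ae (Eventually.of_forall fun t ↦ ?_)
    have hα := ofReal_add_mul_I_ne_zero h3 t
    have hz : riemannZeta₁ (1 + 2 * (c + t * Complex.I)) ≠ 0 :=
      riemannZeta₁_ne_zero_of_half_lt_re hRH (by simp; linarith)
    simp only
    rw [shiftedIntegrand_of_ne_zero M X hα, logDeriv_riemannZeta_one_add_eq hα hz]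
    ring
  rw [key ε (by linarith [hε.1]) le_rfl hε.1.ne', key (-1 / 5) le_rfl (by linarith [hε.1])
    (by norm_num), ← integral_vertical_eq_of_differentiableOn (by linarith [hε.1]) hd hC]
  have v1 : ε * (π / |ε|) - (ε + 1) * (π / |ε + 1|) = 0 := by
    have := hε.1
    rw [abs_of_pos this, abs_of_pos (by linarith)]
    field_simp
    ring
  have v2 : (-1 / 5 : ℝ) * (π / |(-1 / 5 : ℝ)|) - (-1 / 5 + 1) * (π / |(-1 / 5 + 1 : ℝ)|) =
      -2 * π := by
    rw [abs_of_neg (by norm_num), abs_of_pos (by norm_num)]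
    field_simp
    ring
  rw [v1, v2]
  push_cast
  ring

/-- The asymptotic formula for a single integral, with an error term valid for all `X > 0`. -/
theorem exists_norm_vertInt_logDeriv_riemannZeta_sub_le
    (hRH : ∀ s : ℂ, 0 < s.re → s.re < 1 → riemannZeta s = 0 → s.re = 1 / 2)
    {Φ : ℝ → ℝ} (hΦ : ContDiff ℝ (⊤ : ℕ∞) Φ) (hΦc : HasCompactSupport Φ) :
    ∃ C : ℝ, ∀ ε ∈ Set.Ioo (0 : ℝ) (1 / 4), ∀ X : ℝ, 0 < X →
      ‖vertInt (fun α ↦ deriv riemannZeta (1 + 2 * α) / riemannZeta (1 + 2 * α) *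
        mellinC Φ (1 / 2 + α) * (X : ℂ) ^ α) ε - -(π : ℂ) * Complex.I * mellinC Φ (1 / 2)‖ ≤
        C * X ^ (-(1 : ℝ) / 5) := by
  obtain ⟨B, hB⟩ := exists_norm_mellinC_mul_pow_le 4 hΦ hΦc (by norm_num : (0 : ℝ) < 3 / 10)
    (by norm_num : (3 / 10 : ℝ) ≤ 3 / 4)
  set M : ℂ → ℂ := fun α ↦ mellinC Φ (1 / 2 + α) with hMdef
  have hM : DifferentiableOn ℂ M {z | -1 / 4 < z.re} := fun z (hz : -1 / 4 < z.re) ↦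
    ((differentiableAt_mellinC hΦ.continuous hΦc (by simp; linarith)).comp z
      (by fun_prop)).differentiableWithinAt
  have hMB : ∀ z : ℂ, -1 / 5 ≤ z.re → z.re ≤ 1 / 4 → ‖M z‖ * z.im ^ 4 ≤ B := by
    intro z h1 h2
    refine le_trans ?_ (hB (1 / 2 + z) (by simp; linarith) (by simp; linarith))
    have : |z.im| ≤ ‖1 / 2 + z‖ := by simpa using Complex.abs_im_le_norm (1 / 2 + z)
    rw [← (show Even 4 by decide).pow_abs]
    gcongr
  refine ⟨∫ t : ℝ, ‖(fun α ↦ deriv riemannZeta (1 + 2 * α) / riemannZeta (1 + 2 * α) * M α)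
    (((-1 / 5 : ℝ) : ℂ) + t * Complex.I)‖, fun ε hε X hX ↦ ?_⟩
  have hM0 : mellinC Φ (1 / 2) = M 0 := by simp [hMdef]
  rw [vertInt, hM0, integral_logDeriv_riemannZeta_mul_shift hRH hM hMB hX hε, mul_sub,
    show ∀ a b c : ℂ, c * a - c * (π * b) - -(π : ℂ) * c * b = c * a by intros; ring,
    norm_mul, Complex.norm_I, one_mul, ← integral_mul_const]
  refine (norm_integral_le_integral_norm _).trans (le_of_eq ?_)
  refine integral_congr_ae (Eventually.of_forall fun t ↦ ?_)
  simp only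
  rw [norm_mul, Complex.norm_cpow_eq_rpow_re_of_pos hX]
  congr 2
  simp

theorem vertInt_const_mul (c : ℂ) (g : ℂ → ℂ) (σ : ℝ) :
    vertInt (fun z ↦ c * g z) σ = c * vertInt g σ := by
  rw [vertInt, integral_const_mul, vertInt]
  ring

theorem zeta_log_deriv_single_and_double
    (hRH : ∀ s : ℂ, 0 < s.re → s.re < 1 → riemannZeta s = 0 → s.re = 1 / 2)
    (Φ : ℝ → ℝ) (hΦ : ContDiff ℝ (⊤ : ℕ∞) Φ) (hΦc : HasCompactSupport Φ)
    (hΦsupp : Function.support Φ ⊆ Set.Ioi 0)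
    (ε : ℝ) (hε : ε ∈ Set.Ioo (0:ℝ) (1/4)) :
    ((fun X : ℝ =>
          vertInt
              (fun α =>
                deriv riemannZeta (1 + 2 * α) / riemannZeta (1 + 2 * α) *
                    mellinC Φ (1 / 2 + α) * (X : ℂ) ^ α)
              ε -
            -(π : ℂ) * Complex.I * mellinC Φ (1 / 2))
        =O[atTop] (fun X : ℝ => X ^ (-(1 : ℝ) / 5))) ∧
      ∀ ε₁ ∈ Set.Ioo (0:ℝ) (1/4), ∀ ε₂ ∈ Set.Ioo (0:ℝ) (1/4),
        (fun X : ℝ =>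
            vertInt
                (fun β =>
                  vertInt
                    (fun α =>
                      deriv riemannZeta (1 + 2 * α) / riemannZeta (1 + 2 * α) *
                          (deriv riemannZeta (1 + 2 * β) / riemannZeta (1 + 2 * β)) *
                          mellinC Φ (1 / 2 + α) * mellinC Φ (1 / 2 + β) *
                          (X : ℂ) ^ (α + β))
                    ε₁)
                ε₂ -
              -(π : ℂ) ^ 2 * mellinC Φ (1 / 2) ^ 2)
          =O[atTop] (fun X : ℝ => X ^ (-(1 : ℝ) / 5)) := by
  obtain ⟨C, hC⟩ := exists_norm_vertInt_logDeriv_riemannZeta_sub_le hRH hΦ hΦc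
  have single : ∀ ε ∈ Set.Ioo (0 : ℝ) (1 / 4), (fun X : ℝ ↦ vertInt (fun α ↦
      deriv riemannZeta (1 + 2 * α) / riemannZeta (1 + 2 * α) * mellinC Φ (1 / 2 + α) *
        (X : ℂ) ^ α) ε - -(π : ℂ) * Complex.I * mellinC Φ (1 / 2))
      =O[atTop] (fun X : ℝ ↦ X ^ (-(1 : ℝ) / 5)) := by
    intro ε hε
    refine IsBigO.of_bound C ?_
    filter_upwards [eventually_gt_atTop 0] with X hX
    rw [Real.norm_of_nonneg (rpow_nonneg hX.le _)]
    exact hC ε hε X hX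
  refine ⟨single ε hε, fun ε₁ hε₁ ε₂ hε₂ ↦ ?_⟩
  have hle : (fun X : ℝ ↦ X ^ (-(1 : ℝ) / 5)) =O[atTop] fun _ ↦ (1 : ℝ) := by
    refine IsBigO.of_bound 1 ?_
    filter_upwards [eventually_ge_atTop 1] with X hX
    rw [Real.norm_of_nonneg (rpow_nonneg (by linarith) _)]
    simpa using rpow_le_one_of_one_le_of_nonpos hX (by norm_num)
  have h12 := (single ε₁ hε₁).mul ((single ε₂ hε₂).trans hle)
  simp only [mul_one] at h12
  refine ((h12.add ((single ε₁ hε₁).const_mul_left (-(π : ℂ) * Complex.I * mellinC Φ (1 / 2)))).add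
    ((single ε₂ hε₂).const_mul_left (-(π : ℂ) * Complex.I * mellinC Φ (1 / 2)))).congr' ?_
    EventuallyEq.rfl
  filter_upwards [eventually_gt_atTop 0] with X hX
  have hX' : (X : ℂ) ≠ 0 := by exact_mod_cast hX.ne'
  have hprod : ∀ α β : ℂ, deriv riemannZeta (1 + 2 * α) / riemannZeta (1 + 2 * α) *
      (deriv riemannZeta (1 + 2 * β) / riemannZeta (1 + 2 * β)) * mellinC Φ (1 / 2 + α) *
        mellinC Φ (1 / 2 + β) * (X : ℂ) ^ (α + β) =
      (deriv riemannZeta (1 + 2 * β) / riemannZeta (1 + 2 * β) * mellinC Φ (1 / 2 + β) *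
        (X : ℂ) ^ β) * (deriv riemannZeta (1 + 2 * α) / riemannZeta (1 + 2 * α) *
        mellinC Φ (1 / 2 + α) * (X : ℂ) ^ α) := by
    intro α β
    rw [cpow_add _ _ hX']
    ring
  simp_rw [hprod, vertInt_const_mul, mul_comm _ (vertInt _ ε₁), vertInt_const_mul]
  linear_combination -(π : ℂ) ^ 2 * mellinC Φ (1 / 2) ^ 2 * Complex.I_sq
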